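/- arXiv:0904.2955 — 2 statements merged into one kernel-verified Lean document; each statement's English description precedes it below -/
import Mathlib

section
/- A λ-term is strongly normalizing for β-reduction if and only if it is typable in system 𝒟 (the intersection type system with arrow and conjunction types). -/
/-- Untyped λ-terms in de Bruijn representation. -/
inductive Lam : Type
  | var : ℕ → Lam
  | lam : Lam → Lam
  | app : Lam → Lam → Lam

namespace Lam

/-- Renaming of de Bruijn indices (extended under binders). -/
def rename (f : ℕ → ℕ) : Lam → Lam
  | var n => var (f n)
  | lam b => lam (rename (fun n => match n with | 0 => 0 | m+1 => f m + 1) b)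
  | app a b => app (rename f a) (rename f b)

/-- Shift all free indices up by one. -/
def shift : Lam → Lam := rename Nat.succ

/-- Swap the two innermost free indices. -/
def swap01 : Lam → Lam := rename (fun n => match n with | 0 => 1 | 1 => 0 | m => m)

/-- Capture-avoiding substitution of `u` for the free variable (index) `k`. -/
def subst : Lam → ℕ → Lam → Lam
  | var n, k, u => if n = k then u else if k < n then var (n-1) else var n
  | lam b, k, u => lam (subst b (k+1) (shift u))
  | app a b, k, u => app (subst a k u) (subst b k u)

/-- The names of the four reduction rules. -/
inductive Rule | beta | delta | gamma | assoc

/-- One-step reduction by a given rule, closed under all term contexts.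
β : (λx.M) N ▷ M[x:=N]
δ : (λy.λx.M) N ▷ λx.((λy.M) N)   (x ∉ FV N)
γ : ((λx.M) N) P ▷ (λx.(M P)) N   (x ∉ FV P)
assoc : M ((λx.N) P) ▷ (λx.(M N)) P   (x ∉ FV M) -/
inductive StepR : Rule → Lam → Lam → Prop
  | beta (M N) : StepR .beta (app (lam M) N) (subst M 0 N)
  | delta (M N) : StepR .delta (app (lam (lam M)) N) (lam (app (lam (swap01 M)) (shift N)))
  | gamma (M N P) : StepR .gamma (app (app (lam M) N) P) (app (lam (app M (shift P))) N)
  | assoc (M N P) : StepR .assoc (app M (app (lam N) P)) (app (lam (app (shift M) N)) P)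
  | appL {r M M'} (N) : StepR r M M' → StepR r (app M N) (app M' N)
  | appR {r N N'} (M) : StepR r N N' → StepR r (app M N) (app M N')
  | under {r M M'} : StepR r M M' → StepR r (lam M) (lam M')

/-- One-step reduction by any of β, δ, γ, assoc. -/
def Step (t t' : Lam) : Prop := ∃ r, StepR r t t'

/-- One-step β-reduction alone. -/
def StepBeta : Lam → Lam → Prop := StepR Rule.beta

/-- `t` is strongly normalizing for the reduction relation `R`:
every `R`-reduction sequence from `t` is finite. -/
def SN (R : Lam → Lam → Prop) (t : Lam) : Prop := Acc (fun a b => R b a) t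

/-- Left-nested application `(H M₁ … Mₙ)`. -/
def apps : Lam → List Lam → Lam
  | H, [] => H
  | H, M :: Ms => apps (app H M) Ms

/-- Types of system 𝒟 : atoms, arrow and intersection. -/
inductive Ty : Type
  | atom : ℕ → Ty
  | arrow : Ty → Ty → Ty
  | inter : Ty → Ty → Ty

/-- Typing judgment of system 𝒟 (contexts are lists of types, de Bruijn style). -/
inductive Typed : List Ty → Lam → Ty → Prop
  | var {Γ n A} : Γ[n]? = some A → Typed Γ (var n) A
  | app {Γ M N A B} : Typed Γ M (.arrow A B) → Typed Γ N A → Typed Γ (app M N) B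
  | lam {Γ M A B} : Typed (A :: Γ) M B → Typed Γ (lam M) (.arrow A B)
  | interI {Γ M A B} : Typed Γ M A → Typed Γ M B → Typed Γ M (.inter A B)
  | interE1 {Γ M A B} : Typed Γ M (.inter A B) → Typed Γ M A
  | interE2 {Γ M A B} : Typed Γ M (.inter A B) → Typed Γ M B

/-- A term is typable in system 𝒟 if it has a type in some context. -/
def Typable (t : Lam) : Prop := ∃ Γ A, Typed Γ t A

end Lam

namespace Lam

/-! ### Simultaneous substitution -/

/-- Prepend a value to a sequence. -/
def scons {α : Type} (a : α) (f : ℕ → α) : ℕ → α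
  | 0 => a
  | n + 1 => f n

@[simp] theorem scons_zero {α : Type} (a : α) (f : ℕ → α) : scons a f 0 = a := rfl

@[simp] theorem scons_succ {α : Type} (a : α) (f : ℕ → α) (n : ℕ) :
    scons a f (n + 1) = f n := rfl

/-- Extend a renaming under a binder. -/
def upRen (f : ℕ → ℕ) : ℕ → ℕ := scons 0 (fun n => f n + 1)

/-- Extend a simultaneous substitution under a binder. -/
def upSub (σ : ℕ → Lam) : ℕ → Lam := scons (var 0) (fun n => shift (σ n))

/-- Simultaneous substitution. -/
def inst (σ : ℕ → Lam) : Lam → Lam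
  | var n => σ n
  | lam b => lam (inst (upSub σ) b)
  | app a b => app (inst σ a) (inst σ b)

theorem rename_lam (f : ℕ → ℕ) (b : Lam) : rename f (lam b) = lam (rename (upRen f) b) := by
  have h : (fun n => match n with | 0 => 0 | m+1 => f m + 1 : ℕ → ℕ) = upRen f := by
    funext n; cases n <;> rfl
  rw [← h]; rfl

theorem rename_eq_inst (M : Lam) (f : ℕ → ℕ) : rename f M = inst (fun n => var (f n)) M := by
  induction M generalizing f with
  | var n => rfl
  | lam b ih =>
    rw [rename_lam, ih, inst]
    congr 2
    funext n; cases n <;> rfl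
  | app a b iha ihb => rw [rename, inst, iha, ihb]

theorem inst_rename (M : Lam) (f : ℕ → ℕ) (σ : ℕ → Lam) :
    inst σ (rename f M) = inst (fun n => σ (f n)) M := by
  induction M generalizing f σ with
  | var n => rfl
  | lam b ih =>
    rw [rename_lam, inst, inst, ih]
    congr 2
    funext n; cases n <;> rfl
  | app a b iha ihb => rw [rename, inst, inst, iha, ihb]

theorem rename_rename (M : Lam) (f g : ℕ → ℕ) :
    rename g (rename f M) = rename (fun n => g (f n)) M := by
  rw [rename_eq_inst _ g, inst_rename, rename_eq_inst]

theorem rename_inst (M : Lam) (σ : ℕ → Lam) (f : ℕ → ℕ) :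
    rename f (inst σ M) = inst (fun n => rename f (σ n)) M := by
  induction M generalizing f σ with
  | var n => rfl
  | lam b ih =>
    rw [inst, rename_lam, inst, ih]
    congr 2
    funext n
    cases n with
    | zero => rfl
    | succ n => simp only [upSub, scons_succ, shift, rename_rename]; rfl
  | app a b iha ihb => rw [inst, rename, inst, iha, ihb]

theorem inst_inst (M : Lam) (σ τ : ℕ → Lam) :
    inst τ (inst σ M) = inst (fun n => inst τ (σ n)) M := by
  induction M generalizing σ τ with
  | var n => rfl
  | lam b ih =>
    rw [inst, inst, inst, ih]
    congr 2
    funext n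
    cases n with
    | zero => rfl
    | succ n => simp only [upSub, scons_succ, shift, inst_rename, rename_inst]
  | app a b iha ihb => rw [inst, inst, inst, iha, ihb]

theorem inst_var (M : Lam) : inst var M = M := by
  induction M with
  | var n => rfl
  | lam b ih =>
    have h : upSub var = var := by funext n; cases n <;> rfl
    rw [inst, h, ih]
  | app a b iha ihb => rw [inst, iha, ihb]

theorem subst_eq_inst_ite (M : Lam) (k : ℕ) (u : Lam) :
    subst M k u = inst (fun n => if n = k then u else if k < n then var (n - 1) else var n) M := by
  induction M generalizing k u with
  | var n => rfl
  | lam b ih =>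
    rw [subst, inst, ih]
    congr 2
    funext n
    cases n with
    | zero => simp [upSub]
    | succ n =>
      simp only [upSub, scons_succ, add_left_inj, add_lt_add_iff_right]
      split_ifs with h₁ h₂
      · rfl
      · simp only [shift, rename, Nat.add_sub_cancel, var.injEq]; omega
      · rfl
  | app a b iha ihb => rw [subst, inst, iha, ihb]

theorem subst_zero_eq_inst (M u : Lam) : subst M 0 u = inst (scons u var) M := by
  rw [subst_eq_inst_ite]
  congr 1
  funext n
  cases n <;> simp

theorem inst_scons_inst_upSub (M u : Lam) (σ : ℕ → Lam) :
    inst (scons u var) (inst (upSub σ) M) = inst (scons u σ) M := by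
  rw [inst_inst]
  congr 1
  funext n
  cases n with
  | zero => rfl
  | succ n => exact (inst_rename _ _ _).trans (inst_var _)

theorem inst_subst_zero (M N : Lam) (σ : ℕ → Lam) :
    inst σ (subst M 0 N) = subst (inst (upSub σ) M) 0 (inst σ N) := by
  rw [subst_zero_eq_inst, subst_zero_eq_inst, inst_scons_inst_upSub, inst_inst]
  congr 1
  funext n
  cases n <;> rfl

theorem StepBeta.inst {M M' : Lam} (h : StepBeta M M') (σ : ℕ → Lam) :
    StepBeta (inst σ M) (inst σ M') := by
  unfold StepBeta at h
  generalize hr : Rule.beta = r at h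
  induction h generalizing σ with
  | beta M N => rw [inst_subst_zero]; exact .beta _ _
  | appL N _ ih => exact .appL _ (ih σ hr)
  | appR N _ ih => exact .appR _ (ih σ hr)
  | under _ ih => exact .under (ih _ hr)
  | _ => cases hr

theorem SN.of_inst {M : Lam} (σ : ℕ → Lam) (h : SN StepBeta (inst σ M)) : SN StepBeta M := by
  generalize ht : Lam.inst σ M = t at h
  unfold SN at h
  induction h generalizing M with
  | intro t _ ih =>
    subst ht
    exact ⟨_, fun M' hM' => ih _ (StepBeta.inst hM' σ) rfl⟩

theorem SN.of_app_left {M N : Lam} (h : SN StepBeta (app M N)) : SN StepBeta M := by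
  generalize ht : app M N = t at h
  unfold SN at h
  induction h generalizing M with
  | intro t _ ih =>
    subst ht
    exact ⟨_, fun M' hM' => ih _ (StepR.appL N hM') rfl⟩

/-! ### Typing in total contexts -/

/-- Typing of system 𝒟 with contexts assigning a type to every index. -/
inductive TypedFun : (ℕ → Ty) → Lam → Ty → Prop
  | var (Γ : ℕ → Ty) (n : ℕ) : TypedFun Γ (var n) (Γ n)
  | app {Γ M N A B} : TypedFun Γ M (.arrow A B) → TypedFun Γ N A → TypedFun Γ (app M N) B
  | lam {Γ M A B} : TypedFun (scons A Γ) M B → TypedFun Γ (lam M) (.arrow A B)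
  | interI {Γ M A B} : TypedFun Γ M A → TypedFun Γ M B → TypedFun Γ M (.inter A B)
  | interE1 {Γ M A B} : TypedFun Γ M (.inter A B) → TypedFun Γ M A
  | interE2 {Γ M A B} : TypedFun Γ M (.inter A B) → TypedFun Γ M B

theorem Typed.typedFun {L : List Ty} {M : Lam} {A : Ty} (h : Typed L M A) :
    TypedFun (fun n => L[n]?.getD (.atom 0)) M A := by
  induction h with
  | @var Γ n A h =>
    have := TypedFun.var (fun n => Γ[n]?.getD (.atom 0)) n
    simpa [h] using this
  | app _ _ ih₁ ih₂ => exact .app ih₁ ih₂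
  | @lam Γ M A B _ ih =>
    refine .lam ?_
    convert ih using 1
    funext n; cases n <;> simp
  | interI _ _ ih₁ ih₂ => exact .interI ih₁ ih₂
  | interE1 _ ih => exact .interE1 ih
  | interE2 _ ih => exact .interE2 ih

theorem TypedFun.exists_typed {Γ : ℕ → Ty} {M : Lam} {A : Ty} (h : TypedFun Γ M A) :
    ∃ k, ∀ n ≥ k, Typed ((List.range n).map Γ) M A := by
  induction h with
  | var Γ m => exact ⟨m + 1, fun n hn => .var (by simp [List.getElem?_range (show m < n by omega)])⟩
  | app _ _ ih₁ ih₂ =>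
    obtain ⟨k, hk⟩ := ih₁
    obtain ⟨l, hl⟩ := ih₂
    exact ⟨max k l, fun n hn => .app (hk n (by omega)) (hl n (by omega))⟩
  | @lam Γ M A B _ ih =>
    obtain ⟨k, hk⟩ := ih
    refine ⟨k, fun n hn => .lam ?_⟩
    have := hk (n + 1) (by omega)
    rw [List.range_succ_eq_map, List.map_cons, List.map_map] at this
    exact this
  | interI _ _ ih₁ ih₂ =>
    obtain ⟨k, hk⟩ := ih₁
    obtain ⟨l, hl⟩ := ih₂
    exact ⟨max k l, fun n hn => .interI (hk n (by omega)) (hl n (by omega))⟩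
  | interE1 _ ih => exact ih.imp fun k hk n hn => .interE1 (hk n hn)
  | interE2 _ ih => exact ih.imp fun k hk n hn => .interE2 (hk n hn)

theorem typable_iff_exists_typedFun (M : Lam) : Typable M ↔ ∃ Γ A, TypedFun Γ M A := by
  constructor
  · rintro ⟨L, A, h⟩
    exact ⟨_, A, h.typedFun⟩
  · rintro ⟨Γ, A, h⟩
    obtain ⟨k, hk⟩ := h.exists_typed
    exact ⟨_, A, hk k le_rfl⟩

theorem scons_comp_upRen (A : Ty) (Γ : ℕ → Ty) (f : ℕ → ℕ) :
    (fun n => scons A Γ (upRen f n)) = scons A (fun n => Γ (f n)) := by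
  funext n; cases n <;> rfl

theorem typedFun_rename_iff {Γ : ℕ → Ty} {M : Lam} {A : Ty} {f : ℕ → ℕ} :
    TypedFun Γ (rename f M) A ↔ TypedFun (fun n => Γ (f n)) M A := by
  constructor
  · intro h
    generalize ht : rename f M = t at h
    induction h generalizing M f with
    | var Γ m =>
      cases M with
      | var n => cases ht; exact .var _ n
      | lam => cases ht
      | app => cases ht
    | app _ _ ih₁ ih₂ =>
      cases M with
      | app => cases ht; exact .app (ih₁ rfl) (ih₂ rfl)
      | var => cases ht
      | lam => cases ht
    | lam _ ih =>
      cases M with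
      | lam =>
        rw [rename_lam] at ht
        cases ht
        have := ih rfl
        rw [scons_comp_upRen] at this
        exact .lam this
      | var => cases ht
      | app => cases ht
    | interI _ _ ih₁ ih₂ => exact .interI (ih₁ ht) (ih₂ ht)
    | interE1 _ ih => exact .interE1 (ih ht)
    | interE2 _ ih => exact .interE2 (ih ht)
  · intro h
    generalize hΔ : (fun n => Γ (f n)) = Δ at h
    induction h generalizing Γ f with
    | var Δ m => subst hΔ; exact .var Γ (f m)
    | app _ _ ih₁ ih₂ => exact .app (ih₁ hΔ) (ih₂ hΔ)
    | lam _ ih =>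
      rw [rename_lam]
      exact .lam (ih (by rw [scons_comp_upRen, hΔ]))
    | interI _ _ ih₁ ih₂ => exact .interI (ih₁ hΔ) (ih₂ hΔ)
    | interE1 _ ih => exact .interE1 (ih hΔ)
    | interE2 _ ih => exact .interE2 (ih hΔ)

theorem typedFun_scons_shift_iff {Γ : ℕ → Ty} {M : Lam} {A B : Ty} :
    TypedFun (scons B Γ) (shift M) A ↔ TypedFun Γ M A :=
  typedFun_rename_iff

theorem TypedFun.of_context_le {Γ Δ : ℕ → Ty} {M : Lam} {A : Ty} (h : TypedFun Δ M A)
    (hΓ : ∀ n, TypedFun Γ (Lam.var n) (Δ n)) : TypedFun Γ M A := by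
  induction h generalizing Γ with
  | var Δ m => exact hΓ m
  | app _ _ ih₁ ih₂ => exact .app (ih₁ hΓ) (ih₂ hΓ)
  | @lam Δ M A B _ ih =>
    refine .lam (ih fun n => ?_)
    cases n with
    | zero => exact .var (scons A Γ) 0
    | succ n => exact typedFun_scons_shift_iff.2 (hΓ n)
  | interI _ _ ih₁ ih₂ => exact .interI (ih₁ hΓ) (ih₂ hΓ)
  | interE1 _ ih => exact .interE1 (ih hΓ)
  | interE2 _ ih => exact .interE2 (ih hΓ)

theorem TypedFun.inter_left {Γ : ℕ → Ty} {M : Lam} {A : Ty} (h : TypedFun Γ M A)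
    (Δ : ℕ → Ty) : TypedFun (fun n => .inter (Γ n) (Δ n)) M A :=
  h.of_context_le fun n => .interE1 (.var (fun n => .inter (Γ n) (Δ n)) n)

theorem TypedFun.inter_right {Δ : ℕ → Ty} {M : Lam} {A : Ty} (h : TypedFun Δ M A)
    (Γ : ℕ → Ty) : TypedFun (fun n => .inter (Γ n) (Δ n)) M A :=
  h.of_context_le fun n => .interE2 (.var (fun n => .inter (Γ n) (Δ n)) n)

/-! ### Strongly normalizing terms are typable -/

theorem TypedFun.exists_of_inst_var {Γ : ℕ → Ty} {n : ℕ} {A : Ty} {σ : ℕ → Lam}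
    (h : TypedFun Γ (σ n) A) (hσ : ∀ n, ∃ B, TypedFun Γ (σ n) B) :
    ∃ Δ, TypedFun Δ (Lam.var n) A ∧ ∀ m, TypedFun Γ (σ m) (Δ m) := by
  choose Δ hΔ using hσ
  refine ⟨Function.update Δ n A, ?_, fun m => ?_⟩
  · simpa using TypedFun.var (Function.update Δ n A) n
  · by_cases hm : m = n
    · subst hm; simpa using h
    · simpa [hm] using hΔ m

theorem TypedFun.exists_of_inst {Γ : ℕ → Ty} {M : Lam} {A : Ty} {σ : ℕ → Lam}
    (h : TypedFun Γ (inst σ M) A) (hσ : ∀ n, ∃ B, TypedFun Γ (σ n) B) :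
    ∃ Δ, TypedFun Δ M A ∧ ∀ n, TypedFun Γ (σ n) (Δ n) := by
  generalize ht : inst σ M = t at h
  induction h generalizing M σ with
  | var Γ m =>
    cases M with
    | var n => exact exists_of_inst_var (by rw [show σ n = _ from ht]; exact .var Γ m) hσ
    | lam => cases ht
    | app => cases ht
  | app h₁ h₂ ih₁ ih₂ =>
    cases M with
    | var n => exact exists_of_inst_var (by rw [show σ n = _ from ht]; exact .app h₁ h₂) hσ
    | lam => cases ht
    | app =>
      cases ht
      obtain ⟨Δ₁, t₁, s₁⟩ := ih₁ hσ rfl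
      obtain ⟨Δ₂, t₂, s₂⟩ := ih₂ hσ rfl
      exact ⟨_, .app (t₁.inter_left Δ₂) (t₂.inter_right Δ₁), fun n => .interI (s₁ n) (s₂ n)⟩
  | @lam Γ P C D h ih =>
    cases M with
    | var n => exact exists_of_inst_var (by rw [show σ n = _ from ht]; exact .lam h) hσ
    | app => cases ht
    | lam =>
      cases ht
      have hup : ∀ n, ∃ B, TypedFun (scons C Γ) (upSub σ n) B := by
        intro n
        cases n with
        | zero => exact ⟨_, .var _ 0⟩
        | succ n => exact (hσ n).imp fun B hB => typedFun_scons_shift_iff.2 hB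
      obtain ⟨Δ, t, s⟩ := ih hup rfl
      refine ⟨fun n => Δ (n + 1), .lam (t.of_context_le fun n => ?_),
        fun n => typedFun_scons_shift_iff.1 (s (n + 1))⟩
      cases n with
      | zero =>
        have h₀ : TypedFun (fun _ => C) (Lam.var 0) (Δ 0) :=
          (typedFun_rename_iff (Γ := scons C Γ) (f := fun _ => 0)).1 (s 0)
        exact (typedFun_rename_iff (Γ := scons C fun n => Δ (n + 1)) (f := fun _ => 0)).2 h₀
      | succ n => exact .var (scons C fun n => Δ (n + 1)) (n + 1)
  | interI _ _ ih₁ ih₂ =>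
    obtain ⟨Δ₁, t₁, s₁⟩ := ih₁ hσ ht
    obtain ⟨Δ₂, t₂, s₂⟩ := ih₂ hσ ht
    exact ⟨_, .interI (t₁.inter_left Δ₂) (t₂.inter_right Δ₁), fun n => .interI (s₁ n) (s₂ n)⟩
  | interE1 _ ih =>
    obtain ⟨Δ, t, s⟩ := ih hσ ht
    exact ⟨Δ, .interE1 t, s⟩
  | interE2 _ ih =>
    obtain ⟨Δ, t, s⟩ := ih hσ ht
    exact ⟨Δ, .interE2 t, s⟩

theorem TypedFun.beta_expansion {Γ : ℕ → Ty} {M N : Lam} {A B : Ty}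
    (h : TypedFun Γ (subst M 0 N) A) (hN : TypedFun Γ N B) :
    TypedFun Γ (Lam.app (Lam.lam M) N) A := by
  rw [subst_zero_eq_inst] at h
  obtain ⟨Δ, t, s⟩ := h.exists_of_inst fun n => by
    cases n with
    | zero => exact ⟨B, hN⟩
    | succ n => exact ⟨_, .var Γ n⟩
  refine .app (.lam (t.of_context_le fun n => ?_)) (s 0)
  cases n with
  | zero => exact .var (scons (Δ 0) Γ) 0
  | succ n => exact typedFun_scons_shift_iff.2 (s (n + 1))

theorem TypedFun.app_congr_left {Γ : ℕ → Ty} {M M' N : Lam} {A : Ty}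
    (h : TypedFun Γ (Lam.app M N) A) (hM : ∀ C, TypedFun Γ M C → TypedFun Γ M' C) :
    TypedFun Γ (Lam.app M' N) A := by
  generalize ht : Lam.app M N = t at h
  induction h with
  | app h₁ h₂ => cases ht; exact .app (hM _ h₁) h₂
  | interI _ _ ih₁ ih₂ => exact .interI (ih₁ hM ht) (ih₂ hM ht)
  | interE1 _ ih => exact .interE1 (ih hM ht)
  | interE2 _ ih => exact .interE2 (ih hM ht)
  | _ => cases ht

/-- `WeakHead N M M'`: weak head reduction of `M` to `M'`, whose contracted redex has
argument `N`. -/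
inductive WeakHead : Lam → Lam → Lam → Prop
  | beta (M N : Lam) : WeakHead N (app (lam M) N) (subst M 0 N)
  | appL {N M M' : Lam} (P : Lam) : WeakHead N M M' → WeakHead N (app M P) (app M' P)

theorem WeakHead.stepBeta {N M M' : Lam} (h : WeakHead N M M') : StepBeta M M' := by
  induction h with
  | beta M N => exact .beta M N
  | appL P _ ih => exact .appL P ih

theorem WeakHead.typedFun {N M M' : Lam} (h : WeakHead N M M') {Γ : ℕ → Ty} {A B : Ty}
    (hM' : TypedFun Γ M' A) (hN : TypedFun Γ N B) : TypedFun Γ M A := by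
  induction h generalizing A with
  | beta M N => exact hM'.beta_expansion hN
  | appL P _ ih => exact hM'.app_congr_left fun C hC => ih hC hN

/-- Terms whose head is a variable. -/
inductive VarHead : Lam → Prop
  | var (n : ℕ) : VarHead (var n)
  | app {M : Lam} (N : Lam) : VarHead M → VarHead (app M N)

theorem varHead_or_weakHead_app (M N : Lam) :
    VarHead (app M N) ∨ ∃ P M', WeakHead P (app M N) M' := by
  induction M generalizing N with
  | var n => exact .inl (.app N (.var n))
  | lam b _ => exact .inr ⟨_, _, .beta b N⟩
  | app a b ih _ =>
    rcases ih b with h | ⟨P, M', h⟩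
    · exact .inl (.app N h)
    · exact .inr ⟨P, _, .appL N h⟩

/-- Immediate subterms. -/
inductive ImmSubterm : Lam → Lam → Prop
  | lam (M : Lam) : ImmSubterm M (lam M)
  | appL (M N : Lam) : ImmSubterm M (app M N)
  | appR (M N : Lam) : ImmSubterm N (app M N)

theorem ImmSubterm.exists_stepBeta {M M' T : Lam} (h : ImmSubterm M T) (hM : StepBeta M M') :
    ∃ T', StepBeta T T' ∧ ImmSubterm M' T' := by
  cases h with
  | lam => exact ⟨_, .under hM, .lam _⟩
  | appL _ N => exact ⟨_, .appL N hM, .appL _ _⟩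
  | appR M _ => exact ⟨_, .appR M hM, .appR _ _⟩

/-- `M` is a one-step reduct or an immediate subterm of `T`. -/
def StepOrSub (M T : Lam) : Prop := StepBeta T M ∨ ImmSubterm M T

theorem ImmSubterm.acc_of_stepBeta {M T : Lam} (hs : ImmSubterm M T)
    (h : ∀ T', StepBeta T T' → Acc StepOrSub T') (M' : Lam) (hM : StepBeta M M') :
    Acc StepOrSub M' := by
  obtain ⟨T', hT, hs'⟩ := hs.exists_stepBeta hM
  exact (h T' hT).inv (.inr hs')

theorem acc_stepOrSub_of_reducts (M : Lam) (h : ∀ M', StepBeta M M' → Acc StepOrSub M') :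
    Acc StepOrSub M := by
  induction M with
  | var n => exact ⟨_, fun P hP => hP.elim (h P) nofun⟩
  | lam b ih =>
    refine ⟨_, fun P hP => hP.elim (h P) fun hs => ?_⟩
    cases hs
    exact ih (ImmSubterm.acc_of_stepBeta (.lam b) h)
  | app a b iha ihb =>
    refine ⟨_, fun P hP => hP.elim (h P) fun hs => ?_⟩
    cases hs with
    | appL => exact iha (ImmSubterm.acc_of_stepBeta (.appL a b) h)
    | appR => exact ihb (ImmSubterm.acc_of_stepBeta (.appR a b) h)

theorem SN.acc_stepOrSub {M : Lam} (h : SN StepBeta M) : Acc StepOrSub M := by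
  unfold SN at h
  induction h with
  | intro M _ ih => exact acc_stepOrSub_of_reducts M ih

theorem exists_typedFun_of_acc {M : Lam} (h : Acc StepOrSub M) :
    (∃ Γ A, TypedFun Γ M A) ∧ (VarHead M → ∀ A, ∃ Γ, TypedFun Γ M A) ∧
      ∀ N M', WeakHead N M M' → ∃ Γ B, TypedFun Γ N B := by
  induction h with
  | intro M _ ih =>
    have hvar : VarHead M → ∀ A, ∃ Γ, TypedFun Γ M A := by
      intro hM A
      cases hM with
      | var n => exact ⟨fun _ => A, .var _ n⟩
      | @app P N hP =>
        obtain ⟨Γ, B, hN⟩ := (ih N (.inr (.appR P N))).1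
        obtain ⟨Δ, hP⟩ := (ih P (.inr (.appL P N))).2.1 hP (.arrow B A)
        exact ⟨_, .app (hP.inter_left Γ) (hN.inter_right Δ)⟩
    have hhead : ∀ N M', WeakHead N M M' → ∃ Γ B, TypedFun Γ N B := by
      intro N M' hM
      cases hM with
      | beta P N => exact (ih N (.inr (.appR _ _))).1
      | appL P hP => exact (ih _ (.inr (.appL _ _))).2.2 _ _ hP
    refine ⟨?_, hvar, hhead⟩
    cases M with
    | var n => exact ⟨fun _ => .atom 0, _, .var _ n⟩
    | lam b =>
      obtain ⟨Γ, A, hb⟩ := (ih b (.inr (.lam b))).1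
      refine ⟨fun n => Γ (n + 1), .arrow (Γ 0) A, .lam ?_⟩
      convert hb using 1
      funext n; cases n <;> rfl
    | app a b =>
      rcases varHead_or_weakHead_app a b with hv | ⟨N, M', hw⟩
      · exact (hvar hv (.atom 0)).imp fun Γ hΓ => ⟨_, hΓ⟩
      · obtain ⟨Γ, A, hM'⟩ := (ih M' (.inl hw.stepBeta)).1
        obtain ⟨Δ, B, hN⟩ := hhead N M' hw
        exact ⟨_, A, hw.typedFun (hM'.inter_left Δ) (hN.inter_right Γ)⟩

/-! ### Typable terms are strongly normalizing -/

/-- Reducibility of a term at a type. -/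
def Red : Ty → Lam → Prop
  | .atom _, M => SN StepBeta M
  | .arrow A B, M => ∀ N, Red A N → Red B (app M N)
  | .inter A B, M => Red A M ∧ Red B M

/-- Terms that are not abstractions. -/
def Neutral (M : Lam) : Prop := ∀ b, M ≠ lam b

theorem Neutral.var (n : ℕ) : Neutral (var n) := nofun

theorem Neutral.app (M N : Lam) : Neutral (app M N) := nofun

theorem not_stepBeta_var (n : ℕ) (M : Lam) : ¬ StepBeta (var n) M := nofun

theorem red_properties (A : Ty) :
    (∀ M, Red A M → SN StepBeta M) ∧ (∀ M M', Red A M → StepBeta M M' → Red A M') ∧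
      ∀ M, Neutral M → (∀ M', StepBeta M M' → Red A M') → Red A M := by
  induction A with
  | atom a => exact ⟨fun _ h => h, fun _ _ h hs => h.inv hs, fun M _ h => ⟨M, h⟩⟩
  | inter A B ihA ihB =>
    exact ⟨fun M h => ihA.1 M h.1,
      fun M M' h hs => ⟨ihA.2.1 M M' h.1 hs, ihB.2.1 M M' h.2 hs⟩,
      fun M hn h => ⟨ihA.2.2 M hn fun M' hs => (h M' hs).1, ihB.2.2 M hn fun M' hs => (h M' hs).2⟩⟩
  | arrow A B ihA ihB =>
    refine ⟨fun M h => ?_, fun M M' h hs N hN => ihB.2.1 _ _ (h N hN) (.appL N hs),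
      fun M hn h N hN => ?_⟩
    · have hv : Red A (var 0) :=
        ihA.2.2 _ (.var 0) fun M' hs => absurd hs (not_stepBeta_var 0 M')
      exact SN.of_app_left (ihB.1 _ (h _ hv))
    · have hsn := ihA.1 N hN
      unfold SN at hsn
      induction hsn with
      | intro N _ ih =>
        refine ihB.2.2 _ (.app M N) fun T hT => ?_
        cases hT with
        | beta P => exact absurd rfl (hn P)
        | appL _ hM => exact h _ hM N hN
        | appR _ hN' => exact ih _ hN' (ihA.2.1 _ _ hN hN')

theorem Red.sn {A : Ty} {M : Lam} (h : Red A M) : SN StepBeta M := (red_properties A).1 M h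

theorem Red.step {A : Ty} {M M' : Lam} (h : Red A M) (hs : StepBeta M M') : Red A M' :=
  (red_properties A).2.1 M M' h hs

theorem Red.of_neutral {A : Ty} {M : Lam} (hn : Neutral M)
    (h : ∀ M', StepBeta M M' → Red A M') : Red A M :=
  (red_properties A).2.2 M hn h

theorem Red.var (A : Ty) (n : ℕ) : Red A (var n) :=
  .of_neutral (.var n) fun M' hs => absurd hs (not_stepBeta_var n M')

theorem Red.lam {A B : Ty} {M : Lam} (h : ∀ N, Red A N → Red B (subst M 0 N)) :
    Red (.arrow A B) (lam M) := by
  intro N hN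
  have hM : SN StepBeta M := by
    have := (h _ (Red.var A 0)).sn
    rw [subst_zero_eq_inst] at this
    exact this.of_inst
  have hN' := hN.sn
  unfold SN at hM hN'
  induction hM generalizing N with
  | intro M _ ihM =>
    induction hN' with
    | intro N hNacc ihN =>
      refine .of_neutral (.app _ N) fun T hT => ?_
      cases hT with
      | beta => exact h N hN
      | appL _ hl =>
        cases hl with
        | under hM' =>
          refine ihM _ hM' (fun P hP => (h P hP).step ?_) N hN ⟨N, hNacc⟩
          rw [subst_zero_eq_inst, subst_zero_eq_inst]
          exact StepBeta.inst hM' _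
      | appR _ hN' => exact ihN _ hN' (hN.step hN')

theorem TypedFun.red_inst {Γ : ℕ → Ty} {M : Lam} {A : Ty} (h : TypedFun Γ M A)
    {σ : ℕ → Lam} (hσ : ∀ n, Red (Γ n) (σ n)) : Red A (inst σ M) := by
  induction h generalizing σ with
  | var Γ n => exact hσ n
  | app _ _ ih₁ ih₂ => exact ih₁ hσ _ (ih₂ hσ)
  | lam _ ih =>
    refine Red.lam fun N hN => ?_
    rw [subst_zero_eq_inst, inst_scons_inst_upSub]
    refine ih fun n => ?_
    cases n with
    | zero => exact hN
    | succ n => exact hσ n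
  | interI _ _ ih₁ ih₂ => exact ⟨ih₁ hσ, ih₂ hσ⟩
  | interE1 _ ih => exact (ih hσ).1
  | interE2 _ ih => exact (ih hσ).2

theorem TypedFun.sn {Γ : ℕ → Ty} {M : Lam} {A : Ty} (h : TypedFun Γ M A) : SN StepBeta M := by
  have := h.red_inst fun n => Red.var (Γ n) n
  rw [inst_var] at this
  exact this.sn

end Lam

open Lam in
/-- A λ-term is strongly normalizing for β-reduction iff
it is typable in system 𝒟. -/
theorem sn_beta_iff_typable (t : Lam) : SN StepBeta t ↔ Typable t := by
  rw [typable_iff_exists_typedFun]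
  exact ⟨fun h => (exists_typedFun_of_acc h.acc_stepOrSub).1, fun ⟨_, _, h⟩ => h.sn⟩
end

section
/- System 𝒟 satisfies subject reduction for the rules β, δ, γ and assoc: if Γ ⊢ t : A in system 𝒟 and t reduces in one step to t' by any of the rules β, δ, γ or assoc, then Γ ⊢ t' : A. -/
namespace Lam

theorem Typed.var_succ {Δ : List Ty} {m : ℕ} {A : Ty} (B : Ty) (h : Typed Δ (.var m) A) :
    Typed (B :: Δ) (.var (m + 1)) A := by
  generalize ht : Lam.var m = t at h
  induction h with
  | var h => cases ht; exact .var (by simpa using h)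
  | app => cases ht
  | lam => cases ht
  | interI _ _ ih₁ ih₂ => exact .interI (ih₁ ht) (ih₂ ht)
  | interE1 _ ih => exact .interE1 (ih ht)
  | interE2 _ ih => exact .interE2 (ih ht)

/-- A renaming that sends every declared variable to a variable having the same type
preserves typing. -/
theorem Typed.rename {Γ Δ : List Ty} {M : Lam} {T : Ty} (h : Typed Γ M T) {f : ℕ → ℕ}
    (hf : ∀ n A, Γ[n]? = some A → Typed Δ (.var (f n)) A) : Typed Δ (M.rename f) T := by
  induction h generalizing Δ f with
  | var h => exact hf _ _ h
  | app _ _ ih₁ ih₂ => exact .app (ih₁ hf) (ih₂ hf)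
  | lam _ ih =>
    refine .lam (ih ?_)
    rintro (_ | n) A hA
    · exact .var hA
    · exact (hf n A hA).var_succ _
  | interI _ _ ih₁ ih₂ => exact .interI (ih₁ hf) (ih₂ hf)
  | interE1 _ ih => exact .interE1 (ih hf)
  | interE2 _ ih => exact .interE2 (ih hf)

theorem rename_id (M : Lam) : M.rename (fun n => n) = M := by
  induction M with
  | var n => rfl
  | lam b ih =>
    have : (fun n : ℕ => match n with | 0 => 0 | m + 1 => m + 1) = fun n => n := by
      funext n; cases n <;> rfl
    simp only [rename]
    exact congrArg lam ((congrArg (fun f => b.rename f) this).trans ih)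
  | app a b iha ihb => simp only [rename, iha, ihb]

theorem Typed.shift {Γ : List Ty} {M : Lam} {T : Ty} (B : Ty) (h : Typed Γ M T) :
    Typed (B :: Γ) M.shift T :=
  h.rename fun _ _ hA => .var (by simpa using hA)

theorem Typed.swap01 {Γ : List Ty} {M : Lam} {A B T : Ty} (h : Typed (B :: A :: Γ) M T) :
    Typed (A :: B :: Γ) M.swap01 T := by
  refine h.rename ?_
  rintro (_ | _ | n) C hC
  · exact .var hC
  · exact .var hC
  · exact .var hC

/-- The type of the innermost variable may be replaced by a more precise one. -/
theorem Typed.narrow {Γ : List Ty} {M : Lam} {A B T : Ty} (h : Typed (A :: Γ) M T)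
    (hB : Typed (B :: Γ) (.var 0) A) : Typed (B :: Γ) M T := by
  rw [← rename_id M]
  refine h.rename ?_
  rintro (_ | n) C hC
  · cases hC; exact hB
  · exact .var hC

theorem shift_subst_var (n k : ℕ) (u : Lam) :
    subst (var (n + 1)) (k + 1) u.shift = (subst (var n) k u).shift := by
  simp only [subst, Nat.add_right_cancel_iff, Nat.add_lt_add_iff_right]
  split_ifs
  · rfl
  · simp only [shift, rename]; congr 1; omega
  · rfl

theorem Typed.subst {Γ Δ : List Ty} {M u : Lam} {T : Ty} {k : ℕ} (h : Typed Γ M T)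
    (hu : ∀ n A, Γ[n]? = some A → Typed Δ ((Lam.var n).subst k u) A) :
    Typed Δ (M.subst k u) T := by
  induction h generalizing Δ k u with
  | var h => exact hu _ _ h
  | app _ _ ih₁ ih₂ => exact .app (ih₁ hu) (ih₂ hu)
  | lam _ ih =>
    refine .lam (ih ?_)
    rintro (_ | n) A hA
    · exact .var hA
    · rw [shift_subst_var]
      exact (hu n A hA).shift _
  | interI _ _ ih₁ ih₂ => exact .interI (ih₁ hu) (ih₂ hu)
  | interE1 _ ih => exact .interE1 (ih hu)
  | interE2 _ ih => exact .interE2 (ih hu)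

theorem Typed.subst_zero {Γ : List Ty} {M N : Lam} {A T : Ty} (hM : Typed (A :: Γ) M T)
    (hN : Typed Γ N A) : Typed Γ (M.subst 0 N) T := by
  refine hM.subst ?_
  rintro (_ | n) B hB
  · cases hB; simpa [Lam.subst] using hN
  · exact .var hB

/-- `T` is an intersection of arrows `A → B` such that `M` has type `B` when its innermost
variable has type `A`. -/
def AbsTyped (Γ : List Ty) (M : Lam) : Ty → Prop
  | .atom _ => False
  | .arrow A B => Typed (A :: Γ) M B
  | .inter A B => AbsTyped Γ M A ∧ AbsTyped Γ M B

theorem Typed.absTyped {Γ : List Ty} {M : Lam} {T : Ty} (h : Typed Γ (.lam M) T) :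
    AbsTyped Γ M T := by
  generalize ht : Lam.lam M = t at h
  induction h with
  | var => cases ht
  | app => cases ht
  | lam h => cases ht; exact h
  | interI _ _ ih₁ ih₂ => exact ⟨ih₁ ht, ih₂ ht⟩
  | interE1 _ ih => exact (ih ht).1
  | interE2 _ ih => exact (ih ht).2

theorem Typed.exists_of_redex {Γ : List Ty} {M N : Lam} {T : Ty}
    (h : Typed Γ (.app (.lam M) N) T) : ∃ A, Typed Γ N A ∧ Typed (A :: Γ) M T := by
  generalize ht : Lam.app (.lam M) N = t at h
  induction h with
  | var => cases ht
  | app h₁ h₂ => cases ht; exact ⟨_, h₂, h₁.absTyped⟩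
  | lam => cases ht
  | interI _ _ ih₁ ih₂ =>
    obtain ⟨A, hA, hMA⟩ := ih₁ ht
    obtain ⟨B, hB, hMB⟩ := ih₂ ht
    exact ⟨.inter A B, .interI hA hB, .interI (hMA.narrow (.interE1 (B := B) (.var rfl)))
      (hMB.narrow (.interE2 (A := A) (.var rfl)))⟩
  | interE1 _ ih =>
    obtain ⟨A, hA, hM⟩ := ih ht
    exact ⟨A, hA, hM.interE1⟩
  | interE2 _ ih =>
    obtain ⟨A, hA, hM⟩ := ih ht
    exact ⟨A, hA, hM.interE2⟩

theorem AbsTyped.delta {Γ : List Ty} {M N : Lam} {A T : Ty} (hN : Typed Γ N A)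
    (h : AbsTyped (A :: Γ) M T) : Typed Γ (.lam (.app (.lam M.swap01) N.shift)) T := by
  induction T with
  | atom => exact h.elim
  | arrow B C => exact .lam (.app (.lam (Typed.swap01 h)) (hN.shift B))
  | inter B C ihB ihC => exact .interI (ihB h.1) (ihC h.2)

theorem Typed.stepR {Γ : List Ty} {t t' : Lam} {T : Ty} {r : Rule} (ht : Typed Γ t T)
    (hstep : StepR r t t') : Typed Γ t' T := by
  induction ht generalizing t' with
  | var => cases hstep
  | app h₁ h₂ ih₁ ih₂ =>
    cases hstep with
    | beta => exact Typed.subst_zero h₁.absTyped h₂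
    | delta => exact AbsTyped.delta h₂ (Typed.absTyped h₁.absTyped)
    | gamma =>
      obtain ⟨C, hN, hM⟩ := h₁.exists_of_redex
      exact .app (.lam (.app hM (h₂.shift C))) hN
    | assoc =>
      obtain ⟨C, hP, hN⟩ := h₂.exists_of_redex
      exact .app (.lam (.app (h₁.shift C) hN)) hP
    | appL _ h => exact .app (ih₁ h) h₂
    | appR _ h => exact .app h₁ (ih₂ h)
  | lam _ ih =>
    cases hstep with
    | under h => exact .lam (ih h)
  | interI _ _ ih₁ ih₂ => exact .interI (ih₁ hstep) (ih₂ hstep)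
  | interE1 _ ih => exact .interE1 (ih hstep)
  | interE2 _ ih => exact .interE2 (ih hstep)

end Lam

open Lam in
/-- Subject reduction for β, δ, γ and assoc in system 𝒟. -/
theorem subject_reduction {Γ : List Ty} {t t' : Lam} {A : Ty}
    (ht : Typed Γ t A) (hstep : Step t t') : Typed Γ t' A := by
  obtain ⟨_, h⟩ := hstep
  exact ht.stepR h
end
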